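/- Let P ⊆ ℝ^n be a polytope. (i) For every continuous convex function β : P → ℝ, the function β∨(x) = sup_{u ∈ P} (⟨u, x⟩ − β(u)) is a P-admissible convex function on ℝ^n, and its Legendre transform satisfies (β∨)*(u) = β(u) for every u ∈ P. (ii) For every P-admissible convex function φ : ℝ^n → ℝ one has sup_{u ∈ P} (⟨u, x⟩ − φ*(u)) = φ(x) for every x ∈ ℝ^n. Hence φ ↦ φ*|_P is a bijection from the set of P-admissible convex functions onto the set of continuous convex functions on P, with inverse β ↦ β∨. -/

import Mathlib

/-- The support function `Ψ_P(x) = sup_{u ∈ P} ⟨u, x⟩` of a set `P ⊆ ℝ^n`. -/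
noncomputable def suppFn {n : ℕ} (P : Set (Fin n → ℝ)) (x : Fin n → ℝ) : ℝ :=
  sSup ((fun u => ∑ i, u i * x i) '' P)

/-- The Legendre transform `φ*(u) = sup_{x ∈ ℝ^n} (⟨u, x⟩ − φ(x))`. -/
noncomputable def legendre {n : ℕ} (φ : (Fin n → ℝ) → ℝ) (u : Fin n → ℝ) : ℝ :=
  sSup (Set.range fun x => (∑ i, u i * x i) - φ x)

/-- `β∨(x) = sup_{u ∈ P} (⟨u, x⟩ − β(u))` for a function `β` on `P`. -/
noncomputable def vee {n : ℕ} (P : Set (Fin n → ℝ)) (β : (Fin n → ℝ) → ℝ)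
    (x : Fin n → ℝ) : ℝ :=
  sSup ((fun u => (∑ i, u i * x i) - β u) '' P)

open Filter Topology in
theorem aux_sep {n : ℕ} {K : Set (Fin n → ℝ)} (hKc : IsClosed K) {f : (Fin n → ℝ) → ℝ}
    (hf : ConvexOn ℝ K f) (hfc : ContinuousOn f K) {u₀ : Fin n → ℝ} (hu₀ : u₀ ∈ K)
    {ε : ℝ} (hε : 0 < ε) :
    ∃ x : Fin n → ℝ, ∀ u ∈ K, u ⬝ᵥ x - f u ≤ u₀ ⬝ᵥ x - f u₀ + ε := by
  have hcl := hKc.epigraph hfc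
  have hcv := hf.convex_epigraph
  have hnot : ((u₀, f u₀ - ε) : (Fin n → ℝ) × ℝ) ∉ {p : (Fin n → ℝ) × ℝ | p.1 ∈ K ∧ f p.1 ≤ p.2} := by
    rintro ⟨-, h⟩
    simp only at h
    linarith
  obtain ⟨g, s, hs, hg⟩ := geometric_hahn_banach_point_closed hcv hcl hnot
  set c : ℝ := g (0, 1) with hc
  set y : Fin n → ℝ := fun i => g (Pi.single i 1, 0) with hy
  have hrep : ∀ (u : Fin n → ℝ) (t : ℝ), g (u, t) = u ⬝ᵥ y + t * c := by
    intro u t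
    have h1 : ((u, t) : (Fin n → ℝ) × ℝ) = (u, 0) + t • ((0 : Fin n → ℝ), (1 : ℝ)) := by
      ext <;> simp
    rw [h1, map_add, map_smul, smul_eq_mul]
    congr 1
    have h2 := LinearMap.pi_apply_eq_sum_univ
      ((g : ((Fin n → ℝ) × ℝ) →ₗ[ℝ] ℝ).comp (LinearMap.inl ℝ (Fin n → ℝ) ℝ)) u
    simp only [LinearMap.comp_apply, LinearMap.inl_apply, ContinuousLinearMap.coe_coe,
      smul_eq_mul] at h2
    rw [h2]
    simp only [dotProduct, hy]
    refine Finset.sum_congr rfl fun i _ => ?_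
    congr 3
    ext j
    simp [Pi.single_apply, eq_comm]
  have h0 := hg (u₀, f u₀) ⟨hu₀, le_rfl⟩
  rw [hrep] at hs h0
  have hcpos : 0 < c := by
    have : 0 < ε * c := by nlinarith
    exact pos_of_mul_pos_right this hε.le
  refine ⟨-(c⁻¹ • y), fun u hu => ?_⟩
  have h1 := hg (u, f u) ⟨hu, le_rfl⟩
  rw [hrep] at h1
  simp only [dotProduct_neg, dotProduct_smul, smul_eq_mul]
  have h2 : u₀ ⬝ᵥ y + (f u₀ - ε) * c ≤ u ⬝ᵥ y + f u * c := by linarith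
  have h3 := mul_le_mul_of_nonneg_left h2 (inv_pos.2 hcpos).le
  have h4 : c⁻¹ * c = 1 := inv_mul_cancel₀ hcpos.ne'
  have h5 : c⁻¹ * (u₀ ⬝ᵥ y + (f u₀ - ε) * c) = c⁻¹ * (u₀ ⬝ᵥ y) + (f u₀ - ε) * (c⁻¹ * c) := by ring
  have h6 : c⁻¹ * (u ⬝ᵥ y + f u * c) = c⁻¹ * (u ⬝ᵥ y) + f u * (c⁻¹ * c) := by ring
  rw [h5, h6, h4] at h3
  linarith

theorem aux_sep_pt {n : ℕ} {K : Set (Fin n → ℝ)} (hKc : IsClosed K) (hK : Convex ℝ K)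
    {u₀ : Fin n → ℝ} (hu₀ : u₀ ∉ K) :
    ∃ (y : Fin n → ℝ) (s : ℝ), (∀ u ∈ K, u ⬝ᵥ y < s) ∧ s < u₀ ⬝ᵥ y := by
  obtain ⟨g, s, hs, hg⟩ := geometric_hahn_banach_closed_point hK hKc hu₀
  have hrep : ∀ u : Fin n → ℝ, g u = u ⬝ᵥ (fun i => g (Pi.single i 1)) := by
    intro u
    have h2 := LinearMap.pi_apply_eq_sum_univ (g : (Fin n → ℝ) →ₗ[ℝ] ℝ) u
    simp only [ContinuousLinearMap.coe_coe, smul_eq_mul] at h2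
    rw [h2]
    simp only [dotProduct]
    refine Finset.sum_congr rfl fun i _ => ?_
    congr 2
    ext j
    simp [Pi.single_apply, eq_comm]
  refine ⟨fun i => g (Pi.single i 1), s, fun u hu => ?_, ?_⟩
  · rw [← hrep]; exact hs u hu
  · rw [← hrep]; exact hg

open Filter Topology in
theorem aux_cont {n : ℕ} (S : Finset (Fin n → ℝ)) {β : (Fin n → ℝ) → ℝ}
    (hβ : ConvexOn ℝ (convexHull ℝ (S : Set (Fin n → ℝ))) β)
    (hl : LowerSemicontinuousOn β (convexHull ℝ (S : Set (Fin n → ℝ))))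
    {C : ℝ} (hC : ∀ u ∈ convexHull ℝ (S : Set (Fin n → ℝ)), β u ≤ C) :
    ContinuousOn β (convexHull ℝ (S : Set (Fin n → ℝ))) := by
  set P := convexHull ℝ (S : Set (Fin n → ℝ)) with hP
  let L : (S → ℝ) → (Fin n → ℝ) := fun w => ∑ s : S, w s • (s : Fin n → ℝ)
  have hLc : Continuous L := by fun_prop
  have hLP : ∀ w ∈ stdSimplex ℝ S, L w ∈ P := by
    intro w hw
    exact (convex_convexHull ℝ _).sum_mem (fun i _ => hw.1 i) hw.2
      (fun i _ => subset_convexHull ℝ _ i.2)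
  let π : stdSimplex ℝ S → P := fun w => ⟨L w, hLP w w.2⟩
  have hπc : Continuous π := by
    exact Continuous.subtype_mk (hLc.comp continuous_subtype_val) _
  have hπs : Function.Surjective π := by
    rintro ⟨u, hu⟩
    rw [hP, Finset.mem_convexHull'] at hu
    obtain ⟨w, h0, h1, h2⟩ := hu
    refine ⟨⟨fun s => w s, fun s => h0 _ s.2, ?_⟩, ?_⟩
    · rw [← h1]; exact Finset.sum_coe_sort S w
    · apply Subtype.ext
      exact (Finset.sum_coe_sort S (fun y => w y • y)).trans h2
  have : CompactSpace (stdSimplex ℝ S) := isCompact_iff_compactSpace.1 (isCompact_stdSimplex ℝ S)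
  have hq := hπc.isClosedMap.isQuotientMap hπc hπs
  rw [continuousOn_iff_continuous_domRestrict, hq.continuous_iff,
    continuous_iff_lower_upperSemicontinuous]
  constructor
  · have h1 : LowerSemicontinuous (P.domRestrict β) := by
      rw [lowerSemicontinuous_restrict_iff]; exact hl
    exact fun w y hy => hπc.continuousAt.eventually (h1 (π w) y hy)
  · intro w₀ y hy
    have hF0 : β (L w₀) < y := hy
    have hD : β (L w₀) ≤ C := hC _ (hLP _ w₀.2)
    obtain ⟨ε, hε0, hε1, hε⟩ : ∃ ε : ℝ, 0 < ε ∧ ε < 1 ∧ (1 - ε) * β (L w₀) + ε * C < y := by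
      have hd : 0 < y - β (L w₀) + (C - β (L w₀)) + 1 := by linarith
      refine ⟨(y - β (L w₀)) / (y - β (L w₀) + (C - β (L w₀)) + 1), ?_, ?_, ?_⟩
      · apply div_pos <;> linarith
      · rw [div_lt_one hd]; linarith
      · set e := (y - β (L w₀)) / (y - β (L w₀) + (C - β (L w₀)) + 1) with he
        have h1 : e * (y - β (L w₀) + (C - β (L w₀)) + 1) = y - β (L w₀) := by
          rw [he]; field_simp
        have h2 : 0 < e := by apply div_pos <;> linarith
        nlinarith
    have hev : ∀ᶠ w : stdSimplex ℝ S in 𝓝 w₀, ∀ s : S, (1 - ε) * (w₀ : S → ℝ) s ≤ (w : S → ℝ) s := by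
      rw [eventually_all]
      intro s
      rcases (w₀.2.1 s).eq_or_lt with h | h
      · refine Eventually.of_forall fun w => ?_
        change 0 = (w₀ : S → ℝ) s at h
        rw [← h, mul_zero]
        exact w.2.1 s
      · have hc : Continuous fun w : stdSimplex ℝ S => (w : S → ℝ) s :=
          (continuous_apply s).comp continuous_subtype_val
        change 0 < (w₀ : S → ℝ) s at h
        have : (1 - ε) * (w₀ : S → ℝ) s < (w₀ : S → ℝ) s := by nlinarith
        exact (hc.continuousAt.eventually (lt_mem_nhds this)).mono fun w hw => le_of_lt hw
    filter_upwards [hev] with w hw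
    change β (L w) < y
    let v : S → ℝ := fun s => ε⁻¹ * ((w : S → ℝ) s - (1 - ε) * (w₀ : S → ℝ) s)
    have hv : v ∈ stdSimplex ℝ S := by
      refine ⟨fun s => mul_nonneg (inv_pos.2 hε0).le (sub_nonneg.2 (hw s)), ?_⟩
      have a1 : ∑ s, (w : S → ℝ) s = 1 := w.2.2
      have a2 : ∑ s, (w₀ : S → ℝ) s = 1 := w₀.2.2
      simp only [v]
      rw [← Finset.mul_sum, Finset.sum_sub_distrib, ← Finset.mul_sum, a1, a2]
      field_simp
      ring
    have hcomb : L w = (1 - ε) • L w₀ + ε • L v := by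
      simp only [L, Finset.smul_sum, ← Finset.sum_add_distrib, smul_smul, ← add_smul]
      refine Finset.sum_congr rfl fun s _ => ?_
      congr 1
      simp only [v]
      field_simp
      ring
    have h1 := hβ.2 (hLP _ w₀.2) (hLP v hv) (by linarith : (0:ℝ) ≤ 1 - ε) hε0.le (by ring)
    change β ((1 - ε) • L w₀ + ε • L v) ≤ (1 - ε) • β (L w₀) + ε • β (L v) at h1
    rw [← hcomb] at h1
    simp only [smul_eq_mul] at h1
    have := hC _ (hLP v hv)
    nlinarith

theorem aux_vee_le {n : ℕ} {P : Set (Fin n → ℝ)} {β : (Fin n → ℝ) → ℝ} {x : Fin n → ℝ} {c : ℝ}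
    (hne : P.Nonempty) (h : ∀ u ∈ P, u ⬝ᵥ x - β u ≤ c) : vee P β x ≤ c := by
  apply csSup_le (hne.image _)
  rintro _ ⟨u, hu, rfl⟩
  exact h u hu

theorem aux_le_vee {n : ℕ} {P : Set (Fin n → ℝ)} {β : (Fin n → ℝ) → ℝ} {x : Fin n → ℝ} {c : ℝ}
    (h : ∀ u ∈ P, u ⬝ᵥ x - β u ≤ c) {u : Fin n → ℝ} (hu : u ∈ P) : u ⬝ᵥ x - β u ≤ vee P β x := by
  apply le_csSup
  · refine ⟨c, ?_⟩
    rintro _ ⟨u, hu, rfl⟩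
    exact h u hu
  · exact ⟨u, hu, rfl⟩

theorem aux_leg_le {n : ℕ} {φ : (Fin n → ℝ) → ℝ} {u : Fin n → ℝ} {c : ℝ}
    (h : ∀ x, u ⬝ᵥ x - φ x ≤ c) : legendre φ u ≤ c := by
  apply csSup_le (Set.range_nonempty _)
  rintro _ ⟨x, rfl⟩
  exact h x

theorem aux_le_leg {n : ℕ} {φ : (Fin n → ℝ) → ℝ} {u : Fin n → ℝ} {c : ℝ}
    (h : ∀ x, u ⬝ᵥ x - φ x ≤ c) (x : Fin n → ℝ) : u ⬝ᵥ x - φ x ≤ legendre φ u := by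
  apply le_csSup
  · refine ⟨c, ?_⟩
    rintro _ ⟨x, rfl⟩
    exact h x
  · exact ⟨x, rfl⟩

theorem aux_supp {n : ℕ} (P : Set (Fin n → ℝ)) (x : Fin n → ℝ) :
    suppFn P x = vee P (fun _ => 0) x := by
  simp [suppFn, vee]

theorem aux_bdd {n : ℕ} {P : Set (Fin n → ℝ)} (hPc : IsCompact P) {β : (Fin n → ℝ) → ℝ}
    (hβ : ContinuousOn β P) (x : Fin n → ℝ) : ∃ c, ∀ u ∈ P, u ⬝ᵥ x - β u ≤ c := by
  have h : ContinuousOn (fun u => u ⬝ᵥ x - β u) P := by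
    refine ContinuousOn.sub ?_ hβ
    simp only [dotProduct]
    fun_prop
  obtain ⟨c, hc⟩ := hPc.bddAbove_image h
  exact ⟨c, fun u hu => hc ⟨u, hu, rfl⟩⟩

/-- part (i) -/
theorem aux_i {n : ℕ} {P : Set (Fin n → ℝ)} (hPc : IsCompact P) (hne : P.Nonempty)
    (β : (Fin n → ℝ) → ℝ) (hβ : ConvexOn ℝ P β) (hβc : ContinuousOn β P) :
    ConvexOn ℝ Set.univ (vee P β) ∧ (∃ C : ℝ, ∀ x, |vee P β x - suppFn P x| ≤ C) ∧
        ∀ u ∈ P, legendre (vee P β) u = β u := by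
  have hle : ∀ x, ∀ u ∈ P, u ⬝ᵥ x - β u ≤ vee P β x := by
    intro x u hu
    obtain ⟨c, hc⟩ := aux_bdd hPc hβc x
    exact aux_le_vee hc hu
  have hle0 : ∀ x, ∀ u ∈ P, u ⬝ᵥ x ≤ suppFn P x := by
    intro x u hu
    obtain ⟨c, hc⟩ := aux_bdd (β := fun _ => 0) hPc continuousOn_const x
    have := aux_le_vee hc hu
    rw [← aux_supp] at this
    linarith
  refine ⟨⟨convex_univ, ?_⟩, ?_, ?_⟩
  · intro x _ y _ a b ha hb hab
    apply aux_vee_le hne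
    intro u hu
    have h1 := mul_le_mul_of_nonneg_left (hle x u hu) ha
    have h2 := mul_le_mul_of_nonneg_left (hle y u hu) hb
    simp only [dotProduct_add, dotProduct_smul, smul_eq_mul]
    have h3 : β u = a * β u + b * β u := by rw [← add_mul, hab, one_mul]
    linarith
  · obtain ⟨M, hM⟩ := hPc.exists_bound_of_continuousOn hβc
    refine ⟨M, fun x => abs_le.2 ⟨?_, ?_⟩⟩
    · have : suppFn P x ≤ vee P β x + M := by
        rw [aux_supp]
        apply aux_vee_le hne
        intro u hu
        have := hle x u hu
        have := (abs_le.1 (hM u hu)).2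
        linarith
      linarith
    · have : vee P β x ≤ suppFn P x + M := by
        apply aux_vee_le hne
        intro u hu
        have := hle0 x u hu
        have := (abs_le.1 (hM u hu)).1
        linarith
      linarith
  · intro u hu
    have hb : ∀ x, u ⬝ᵥ x - vee P β x ≤ β u := fun x => by linarith [hle x u hu]
    apply le_antisymm (aux_leg_le hb)
    apply le_of_forall_pos_le_add
    intro ε hε
    obtain ⟨x, hx⟩ := aux_sep hPc.isClosed hβ hβc hu hε
    have h1 := aux_vee_le hne hx
    have h2 := aux_le_leg hb x
    linarith

theorem aux_adm {n : ℕ} {P : Set (Fin n → ℝ)} (hPc : IsCompact P)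
    {φ : (Fin n → ℝ) → ℝ} {C : ℝ} (hC : ∀ x, |φ x - suppFn P x| ≤ C) :
    ∀ u ∈ P, ∀ x, u ⬝ᵥ x - φ x ≤ C := by
  intro u hu x
  obtain ⟨c, hc⟩ := aux_bdd (β := fun _ => 0) hPc continuousOn_const x
  have := aux_le_vee hc hu
  rw [← aux_supp] at this
  have := (abs_le.1 (hC x)).1
  linarith

/-- part (ii) -/
theorem aux_ii {n : ℕ} {P : Set (Fin n → ℝ)} (hPc : IsCompact P) (hPv : Convex ℝ P)
    (hne : P.Nonempty) (φ : (Fin n → ℝ) → ℝ) (hφ : ConvexOn ℝ Set.univ φ)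
    (h : ∃ C : ℝ, ∀ x, |φ x - suppFn P x| ≤ C) (x : Fin n → ℝ) :
    vee P (legendre φ) x = φ x := by
  obtain ⟨C, hC⟩ := h
  have hadm := aux_adm hPc hC
  have hb : ∀ u ∈ P, u ⬝ᵥ x - legendre φ u ≤ φ x := by
    intro u hu
    have := aux_le_leg (hadm u hu) x
    linarith
  apply le_antisymm (aux_vee_le hne hb)
  apply le_of_forall_pos_le_add
  intro ε hε
  obtain ⟨u, hu⟩ := aux_sep isClosed_univ hφ (hφ.continuousOn isOpen_univ) (Set.mem_univ x) hε
  have hu' : ∀ y, u ⬝ᵥ y - φ y ≤ u ⬝ᵥ x - φ x + ε := by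
    intro y
    have := hu y (Set.mem_univ y)
    rwa [dotProduct_comm y u, dotProduct_comm x u] at this
  have huP : u ∈ P := by
    by_contra hnot
    obtain ⟨y, s, hs, hsu⟩ := aux_sep_pt hPc.isClosed hPv hnot
    set K := u ⬝ᵥ x - φ x + ε with hK
    have key : ∀ t : ℝ, 0 ≤ t → t * (u ⬝ᵥ y - s) ≤ K + C := by
      intro t ht
      have h1 := hu' (t • y)
      have h2 := (abs_le.1 (hC (t • y))).2
      have h3 : suppFn P (t • y) ≤ t * s := by
        rw [aux_supp]
        apply aux_vee_le hne
        intro v hv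
        rw [dotProduct_smul, smul_eq_mul]
        have := mul_le_mul_of_nonneg_left (hs v hv).le ht
        linarith
      rw [dotProduct_smul, smul_eq_mul] at h1
      linarith
    have hd : 0 < u ⬝ᵥ y - s := by linarith
    have h0 := key 0 le_rfl
    rw [zero_mul] at h0
    have h1 := key ((K + C + 1) / (u ⬝ᵥ y - s)) (div_nonneg (by linarith) hd.le)
    rw [div_mul_cancel₀ _ hd.ne'] at h1
    linarith
  have h1 := aux_leg_le hu'
  have h2 := aux_le_vee hb huP
  linarith

theorem aux_leg_conv {n : ℕ} {P : Set (Fin n → ℝ)} (hPv : Convex ℝ P)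
    {φ : (Fin n → ℝ) → ℝ} {C : ℝ} (hC : ∀ u ∈ P, ∀ x, u ⬝ᵥ x - φ x ≤ C) :
    ConvexOn ℝ P (legendre φ) := by
  refine ⟨hPv, ?_⟩
  intro u hu v hv a b ha hb hab
  apply aux_leg_le
  intro x
  have h1 := mul_le_mul_of_nonneg_left (aux_le_leg (hC u hu) x) ha
  have h2 := mul_le_mul_of_nonneg_left (aux_le_leg (hC v hv) x) hb
  simp only [add_dotProduct, smul_dotProduct, smul_eq_mul]
  have h3 : φ x = a * φ x + b * φ x := by rw [← add_mul, hab, one_mul]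
  linarith

open Filter Topology in
theorem aux_leg_lsc {n : ℕ} {P : Set (Fin n → ℝ)}
    {φ : (Fin n → ℝ) → ℝ} {C : ℝ} (hC : ∀ u ∈ P, ∀ x, u ⬝ᵥ x - φ x ≤ C) :
    LowerSemicontinuousOn (legendre φ) P := by
  intro u hu y hy
  obtain ⟨_, ⟨x, rfl⟩, hx⟩ := exists_lt_of_lt_csSup (Set.range_nonempty _) hy
  have hc : Continuous fun v : Fin n → ℝ => (∑ i, v i * x i) - φ x := by fun_prop
  have h1 := (hc.continuousWithinAt (s := P) (x := u)).eventually (lt_mem_nhds hx)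
  filter_upwards [h1, self_mem_nhdsWithin] with v hv hvP
  exact lt_of_lt_of_le hv (aux_le_leg (hC v hvP) x)

/-- (i) for every continuous convex `β` on the polytope `P`, the function `β∨`
is a `P`-admissible convex function and `(β∨)* = β` on `P`; (ii) for every `P`-admissible
convex `φ`, `(φ*|_P)∨ = φ`; hence `φ ↦ φ*|_P` is a bijection from the `P`-admissible convex
functions onto the continuous convex functions on `P`, with inverse `β ↦ β∨`. -/
theorem stmt_1 {n : ℕ} (P : Set (Fin n → ℝ))
    (hP : ∃ S : Finset (Fin n → ℝ), S.Nonempty ∧ P = convexHull ℝ (S : Set (Fin n → ℝ))) :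
    (∀ β : (Fin n → ℝ) → ℝ, ConvexOn ℝ P β → ContinuousOn β P →
      ConvexOn ℝ Set.univ (vee P β) ∧ (∃ C : ℝ, ∀ x, |vee P β x - suppFn P x| ≤ C) ∧
        ∀ u ∈ P, legendre (vee P β) u = β u) ∧
    (∀ φ : (Fin n → ℝ) → ℝ, ConvexOn ℝ Set.univ φ →
      (∃ C : ℝ, ∀ x, |φ x - suppFn P x| ≤ C) → ∀ x, vee P (legendre φ) x = φ x) ∧
    Set.BijOn (fun φ : (Fin n → ℝ) → ℝ => P.restrict (legendre φ))
      {φ | ConvexOn ℝ Set.univ φ ∧ ∃ C : ℝ, ∀ x, |φ x - suppFn P x| ≤ C}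
      {b : P → ℝ | ∃ β : (Fin n → ℝ) → ℝ,
        ConvexOn ℝ P β ∧ ContinuousOn β P ∧ P.restrict β = b} := by
  obtain ⟨S, hS, rfl⟩ := hP
  have hPc : IsCompact (convexHull ℝ (S : Set (Fin n → ℝ))) := S.finite_toSet.isCompact_convexHull (𝕜 := ℝ)
  have hPv := convex_convexHull ℝ (S : Set (Fin n → ℝ))
  have hne : (convexHull ℝ (S : Set (Fin n → ℝ))).Nonempty := by
    rw [convexHull_nonempty_iff]; exact_mod_cast hS
  refine ⟨aux_i hPc hne, aux_ii hPc hPv hne, ?_, ?_, ?_⟩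
  · rintro φ ⟨hφ, C, hC⟩
    have hadm := aux_adm hPc hC
    have hcv := aux_leg_conv hPv hadm
    exact ⟨legendre φ, hcv, aux_cont S hcv (aux_leg_lsc hadm)
      (fun u hu => aux_leg_le (hadm u hu)), rfl⟩
  · rintro φ ⟨hφ, hC⟩ ψ ⟨hψ, hD⟩ heq
    funext x
    rw [← aux_ii hPc hPv hne φ hφ hC x, ← aux_ii hPc hPv hne ψ hψ hD x]
    have : ∀ u ∈ convexHull ℝ (S : Set (Fin n → ℝ)), legendre φ u = legendre ψ u :=
      fun u hu => congrFun heq ⟨u, hu⟩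
    unfold vee
    congr 1
    apply Set.image_congr
    intro u hu
    rw [this u hu]
  · rintro _ ⟨β, hβ, hβc, rfl⟩
    obtain ⟨h1, h2, h3⟩ := aux_i hPc hne β hβ hβc
    refine ⟨vee _ β, ⟨h1, h2⟩, ?_⟩
    funext u
    exact h3 u u.2
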